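/- For every Lipschitz function f on ℝⁿ and every t ∈ (0,1), the Gaussian symmetrization f° satisfies f**(t) - f*(t) ≤ (t/I(t)) |∇f°|**(t), where rearrangements are with respect to Gaussian measure. -/

import Mathlib

open MeasureTheory Real

/-- The standard one-dimensional Gaussian density `φ(x) = (2π)^{-1/2} e^{-x²/2}`. -/
noncomputable def gaussPdf (x : ℝ) : ℝ := (2 * Real.pi) ^ (-(1:ℝ)/2) * Real.exp (-x^2 / 2)

/-- The standard Gaussian cumulative distribution function `Φ(r) = ∫_{-∞}^r φ(t) dt`. -/
noncomputable def gaussCdf (r : ℝ) : ℝ := ∫ t in Set.Iic r, gaussPdf t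

/-- The inverse of `Φ`. -/
noncomputable def gaussCdfInv : ℝ → ℝ := Function.invFun gaussCdf

/-- The Gaussian isoperimetric function `I(t) = φ(Φ⁻¹(t))` on `(0,1)`, with `I(0)=I(1)=0`. -/
noncomputable def Igauss (t : ℝ) : ℝ :=
  if t = 0 ∨ t = 1 then 0 else gaussPdf (gaussCdfInv t)

open scoped ENNReal

/-- The standard Gaussian measure `γₙ` on `ℝⁿ`. -/
noncomputable def gaussMeasure (n : ℕ) : Measure (Fin n → ℝ) :=
  Measure.pi fun _ => ProbabilityTheory.gaussianReal 0 1

/-- The Gaussian distribution function `λ_f(t) = γₙ({|f| > t})`. -/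
noncomputable def distFun (n : ℕ) (f : (Fin n → ℝ) → ℝ) (t : ℝ) : ℝ :=
  (gaussMeasure n {x | t < |f x|}).toReal

/-- The decreasing rearrangement of `f` with respect to `γₙ`:
`f*(s) = inf {t ≥ 0 : λ_f(t) ≤ s}`. -/
noncomputable def rearr (n : ℕ) (f : (Fin n → ℝ) → ℝ) (s : ℝ) : ℝ :=
  sInf {t : ℝ | 0 ≤ t ∧ distFun n f t ≤ s}

/-- The maximal function of the rearrangement, `f**(t) = (1/t) ∫₀ᵗ f*(s) ds`. -/
noncomputable def rearr2 (n : ℕ) (f : (Fin n → ℝ) → ℝ) (t : ℝ) : ℝ :=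
  (1/t) * ∫ s in (0:ℝ)..t, rearr n f s

/-- The modulus of the gradient, `|∇f|(x) = ‖Df(x)‖`. -/
noncomputable def gradNorm (n : ℕ) (f : (Fin n → ℝ) → ℝ) (x : Fin n → ℝ) : ℝ :=
  ‖fderiv ℝ f x‖

/-- The Gaussian symmetrization `f°(x) = f*(Φ(x₁))`. -/
noncomputable def gaussSymm (n : ℕ) [NeZero n] (f : (Fin n → ℝ) → ℝ)
    (x : Fin n → ℝ) : ℝ :=
  rearr n f (gaussCdf (x 0))

open ProbabilityTheory Set Filter Topology
open scoped NNReal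

lemma isGaussian_gm (n : ℕ) : IsGaussian (gaussMeasure n) := by
  have h : iIndepFun (fun (i : Fin n) (ω : Fin n → ℝ) ↦ ω i) (gaussMeasure n) :=
    iIndepFun_pi (X := fun _ ↦ id) (fun _ ↦ aemeasurable_id)
  have h2 : ∀ i : Fin n, HasGaussianLaw (fun ω : Fin n → ℝ ↦ ω i) (gaussMeasure n) := by
    intro i
    constructor
    have := (measurePreserving_eval (fun _ : Fin n => gaussianReal 0 1) i).map_eq
    have h3 : (gaussMeasure n).map (fun ω : Fin n → ℝ ↦ ω i) = gaussianReal 0 1 := this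
    rw [h3]
    infer_instance
  have h4 := (iIndepFun.hasGaussianLaw h2 h).isGaussian_map
  have h5 : (gaussMeasure n).map (fun (ω : Fin n → ℝ) i ↦ ω i) = gaussMeasure n := Measure.map_id
  rwa [h5] at h4

instance isProb_gm (n : ℕ) : IsProbabilityMeasure (gaussMeasure n) :=
  (isGaussian_gm n).toIsProbabilityMeasure

lemma rot_gm (n : ℕ) (θ : ℝ) :
    ((gaussMeasure n).prod (gaussMeasure n)).map
      (fun p : (Fin n → ℝ) × (Fin n → ℝ) => Real.cos θ • p.1 + Real.sin θ • p.2)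
      = gaussMeasure n := by
  have := isGaussian_gm n
  have hint : Integrable (fun x : Fin n → ℝ => x) (gaussMeasure n) := IsGaussian.integrable_id
  have h0 : (gaussMeasure n)[id] = 0 := by
    ext i
    have h1 : (∫ x, id x ∂(gaussMeasure n)) i = ∫ x, x i ∂(gaussMeasure n) := by
      have := (ContinuousLinearMap.proj (R := ℝ) (φ := fun _ : Fin n => ℝ) i).integral_comp_comm hint
      simpa using this.symm
    rw [h1]
    have h2 := (measurePreserving_eval (fun _ : Fin n => gaussianReal 0 1) i)
    have h3 : (gaussMeasure n).map (fun ω : Fin n → ℝ ↦ ω i) = gaussianReal 0 1 := h2.map_eq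
    have h4 : ∫ x, x ∂(gaussianReal 0 1) = 0 := integral_id_gaussianReal
    rw [← h3, integral_map (measurable_pi_apply i).aemeasurable (by fun_prop)] at h4
    simpa using h4
  have h := IsGaussian.map_rotation_eq_self h0 θ
  have h2 : (((gaussMeasure n).prod (gaussMeasure n)).map (ContinuousLinearMap.rotation θ)).map Prod.fst
    = gaussMeasure n := by
    rw [h]; simp
  rw [Measure.map_map (by fun_prop) (by fun_prop)] at h2
  exact h2

/-- crossing lemma -/
lemma crossing {u : ℝ → ℝ} {T : ℝ} {L : ℝ≥0} (hT : 0 ≤ T) (hu : LipschitzWith L u) {a b : ℝ}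
    (h0 : b < u 0) (h1 : u T ≤ a) :
    ENNReal.ofReal (b - a) ≤ L * volume ({θ | a < u θ ∧ u θ ≤ b} ∩ Icc 0 T) := by
  have h2 : Ioc a b ⊆ u '' ({θ | a < u θ ∧ u θ ≤ b} ∩ Icc 0 T) := by
    intro y hy
    have := intermediate_value_Icc' hT hu.continuous.continuousOn
    obtain ⟨θ, hθ, rfl⟩ := this ⟨h1.trans hy.1.le, hy.2.trans h0.le⟩
    exact ⟨θ, ⟨hy, hθ⟩, rfl⟩
  have h3 := hu.hausdorffMeasure_image_le zero_le_one ({θ | a < u θ ∧ u θ ≤ b} ∩ Icc 0 T)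
  rw [hausdorffMeasure_real] at h3
  calc ENNReal.ofReal (b - a) = volume (Ioc a b) := by simp
    _ ≤ _ := measure_mono h2
    _ ≤ _ := by simpa using h3

lemma gap (n : ℕ) {g : (Fin n → ℝ) → ℝ} {K : ℝ≥0} (hg : LipschitzWith K g) {R : ℝ≥0} {δ : ℝ≥0∞}
    (hR : gaussMeasure n {x | R < ‖x‖} ≤ δ / 2) (hδ : δ ≠ ∞) {a b : ℝ}
    (hb : δ ≤ gaussMeasure n {x | b < g x}) (ha : δ ≤ gaussMeasure n {x | g x ≤ a}) :
    ENNReal.ofReal (b - a) * (δ / 2 * (δ / 2)) ≤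
      (K * (2 * R) : ℝ≥0) * ENNReal.ofReal (π / 2) * gaussMeasure n {x | a < g x ∧ g x ≤ b} := by
  set μ := gaussMeasure n with hμ
  set L : ℝ≥0 := K * (2 * R)
  have key : ∀ S : Set (Fin n → ℝ), δ ≤ μ S → δ / 2 ≤ μ (S ∩ {x | ‖x‖ ≤ R}) := by
    intro S hS
    have h1 : μ S ≤ μ (S ∩ {x | ‖x‖ ≤ R}) + μ {x | R < ‖x‖} := by
      refine (measure_mono ?_).trans (measure_union_le _ _)
      intro x hx
      by_cases h : ‖x‖ ≤ R
      · left; exact ⟨hx, h⟩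
      · right; simpa using h
    have h2 : δ / 2 + δ / 2 ≤ μ (S ∩ {x | ‖x‖ ≤ R}) + δ / 2 := by
      rw [ENNReal.add_halves]
      exact hS.trans (h1.trans (by gcongr))
    exact (ENNReal.add_le_add_iff_right (by finiteness)).1 h2
  have gm : Measurable g := hg.continuous.measurable
  set A := {x | b < g x} ∩ {x : Fin n → ℝ | ‖x‖ ≤ R}
  set B := {x | g x ≤ a} ∩ {x : Fin n → ℝ | ‖x‖ ≤ R}
  have hA := key _ hb
  have hB := key _ ha
  set G := {x | a < g x ∧ g x ≤ b}
  have hG : MeasurableSet G := (measurableSet_lt measurable_const gm).inter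
    (measurableSet_le gm measurable_const)
  have pt : ∀ p ∈ A ×ˢ B, ENNReal.ofReal (b - a) ≤ L * ∫⁻ θ in Icc 0 (π/2),
      G.indicator 1 (Real.cos θ • p.1 + Real.sin θ • p.2) := by
    rintro ⟨x, y⟩ ⟨hx, hy⟩
    have hlip : LipschitzWith L (fun θ : ℝ => g (Real.cos θ • x + Real.sin θ • y)) := by
      refine hg.comp ?_
      apply lipschitzWith_of_nnnorm_deriv_le
      · fun_prop
      · intro θ
        have : HasDerivAt (fun θ : ℝ => Real.cos θ • x + Real.sin θ • y)
          ((-Real.sin θ) • x + Real.cos θ • y) θ :=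
          ((Real.hasDerivAt_cos θ).smul_const x).add ((Real.hasDerivAt_sin θ).smul_const y)
        rw [this.deriv]
        rw [← NNReal.coe_le_coe, coe_nnnorm]
        have hx' : ‖x‖ ≤ R := hx.2
        have hy' : ‖y‖ ≤ R := hy.2
        calc _ ≤ ‖(-Real.sin θ) • x‖ + ‖Real.cos θ • y‖ := norm_add_le _ _
          _ = |Real.sin θ| * ‖x‖ + |Real.cos θ| * ‖y‖ := by simp [norm_smul]
          _ ≤ 1 * R + 1 * R := by
            gcongr
            · exact Real.abs_sin_le_one θ
            · exact Real.abs_cos_le_one θ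
          _ = _ := by push_cast; ring
    have := crossing (T := π/2) (by positivity) hlip (a := a) (b := b) (by simpa using hx.1) (by simpa using hy.1)
    refine this.trans ?_
    gcongr
    have hm : MeasurableSet {θ : ℝ | a < g (Real.cos θ • x + Real.sin θ • y) ∧ g (Real.cos θ • x + Real.sin θ • y) ≤ b} := by
      have : Measurable (fun θ : ℝ => Real.cos θ • x + Real.sin θ • y) := by fun_prop
      exact this hG
    rw [← Measure.restrict_apply hm, ← lintegral_indicator_one hm]
    exact lintegral_mono (fun θ => le_of_eq rfl)
  have mAB : MeasurableSet (A ×ˢ B) := by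
    refine MeasurableSet.prod ?_ ?_
    · exact (measurableSet_lt measurable_const gm).inter (measurableSet_le (by fun_prop) measurable_const)
    · exact (measurableSet_le gm measurable_const).inter (measurableSet_le (by fun_prop) measurable_const)
  have mind : Measurable (G.indicator (1 : (Fin n → ℝ) → ℝ≥0∞)) := measurable_one.indicator hG
  calc ENNReal.ofReal (b - a) * (δ / 2 * (δ / 2))
      ≤ ENNReal.ofReal (b - a) * (μ.prod μ) (A ×ˢ B) := by
        rw [Measure.prod_prod]; gcongr
    _ = ∫⁻ p in A ×ˢ B, ENNReal.ofReal (b - a) ∂(μ.prod μ) := by simp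
    _ ≤ ∫⁻ p in A ×ˢ B, L * (∫⁻ θ in Icc 0 (π/2),
      G.indicator 1 (Real.cos θ • p.1 + Real.sin θ • p.2)) ∂(μ.prod μ) :=
        setLIntegral_mono' mAB pt
    _ ≤ ∫⁻ p, L * (∫⁻ θ in Icc 0 (π/2),
      G.indicator 1 (Real.cos θ • p.1 + Real.sin θ • p.2)) ∂(μ.prod μ) := setLIntegral_le_lintegral _ _
    _ = L * ∫⁻ p, (∫⁻ θ in Icc 0 (π/2),
      G.indicator 1 (Real.cos θ • p.1 + Real.sin θ • p.2)) ∂(μ.prod μ) := by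
        rw [lintegral_const_mul' _ _ (by simp)]
    _ = L * ∫⁻ θ in Icc 0 (π/2), ∫⁻ p,
      G.indicator 1 (Real.cos θ • p.1 + Real.sin θ • p.2) ∂(μ.prod μ) := by
        rw [lintegral_lintegral_swap]
        apply Measurable.aemeasurable
        apply mind.comp
        fun_prop
    _ = L * ∫⁻ θ in Icc 0 (π/2), μ G := by
        congr 1
        apply lintegral_congr
        intro θ
        rw [← lintegral_map (f := G.indicator 1) (g := fun p : (Fin n → ℝ) × (Fin n → ℝ) => Real.cos θ • p.1 + Real.sin θ • p.2) mind (by fun_prop), rot_gm, lintegral_indicator_one hG]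
    _ = _ := by
        simp; ring
lemma gaussPdf_eq : gaussPdf = gaussianPDFReal 0 1 := by
  ext x
  simp only [gaussPdf, gaussianPDFReal]
  rw [Real.sqrt_eq_rpow, ← Real.rpow_neg (by positivity)]
  norm_num

lemma gaussPdf_pos (x : ℝ) : 0 < gaussPdf x := by
  unfold gaussPdf; positivity

lemma gaussPdf_cont : Continuous gaussPdf := by
  unfold gaussPdf; fun_prop

lemma gaussPdf_int : Integrable gaussPdf := by
  rw [gaussPdf_eq]; exact integrable_gaussianPDFReal 0 1

lemma gaussCdf_eq (x : ℝ) : gaussCdf x = ProbabilityTheory.cdf (gaussianReal 0 1) x := by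
  rw [cdf_eq_real, Measure.real, gaussianReal_apply_eq_integral _ one_ne_zero,
    ENNReal.toReal_ofReal, gaussCdf, gaussPdf_eq]
  exact integral_nonneg (fun y => gaussianPDFReal_nonneg _ _ _)

lemma gaussCdf_hasDeriv (x : ℝ) : HasDerivAt gaussCdf (gaussPdf x) x := by
  have h : gaussCdf = fun r => gaussCdf 0 + ∫ t in (0:ℝ)..r, gaussPdf t := by
    ext r
    rw [← intervalIntegral.integral_Iic_sub_Iic gaussPdf_int.integrableOn gaussPdf_int.integrableOn]
    simp [gaussCdf]
  rw [h]
  exact ((gaussPdf_cont.integral_hasStrictDerivAt 0 x).hasDerivAt).const_add _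

lemma gaussCdf_strictMono : StrictMono gaussCdf :=
  strictMono_of_hasDerivAt_pos gaussCdf_hasDeriv gaussPdf_pos

lemma gaussCdf_cont : Continuous gaussCdf :=
  continuous_iff_continuousAt.2 fun x => (gaussCdf_hasDeriv x).continuousAt

lemma gaussCdf_pos (x : ℝ) : 0 < gaussCdf x := by
  have h := gaussCdf_strictMono (show x - 1 < x by linarith)
  have h2 : 0 ≤ gaussCdf (x - 1) := by rw [gaussCdf_eq]; exact cdf_nonneg _ _
  linarith

lemma gaussCdf_lt_one (x : ℝ) : gaussCdf x < 1 := by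
  have h := gaussCdf_strictMono (show x < x + 1 by linarith)
  have h2 : gaussCdf (x + 1) ≤ 1 := by rw [gaussCdf_eq]; exact cdf_le_one _ _
  linarith

lemma gaussCdf_range : range gaussCdf = Ioo 0 1 := by
  apply Subset.antisymm
  · rintro _ ⟨x, rfl⟩
    exact ⟨gaussCdf_pos x, gaussCdf_lt_one x⟩
  · intro s hs
    have hb : Tendsto gaussCdf atBot (𝓝 0) := by
      rw [funext gaussCdf_eq]; exact tendsto_cdf_atBot _
    have ht : Tendsto gaussCdf atTop (𝓝 1) := by
      rw [funext gaussCdf_eq]; exact tendsto_cdf_atTop _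
    exact mem_range_of_exists_le_of_exists_ge gaussCdf_cont
      ((hb.eventually (gt_mem_nhds hs.1)).exists.imp fun _ h => h.le)
      ((ht.eventually (lt_mem_nhds hs.2)).exists.imp fun _ h => h.le)

lemma gaussCdfInv_cdf (x : ℝ) : gaussCdfInv (gaussCdf x) = x :=
  Function.leftInverse_invFun gaussCdf_strictMono.injective x

lemma gaussCdf_inv {s : ℝ} (hs : s ∈ Ioo (0:ℝ) 1) : gaussCdf (gaussCdfInv s) = s := by
  rw [← gaussCdf_range] at hs
  exact Function.invFun_eq hs

lemma gaussCdf_shift (x : ℝ) : gaussCdf x = ∫ u in Iic (0:ℝ), gaussPdf (x + u) := by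
  have := (measurePreserving_add_left (volume : Measure ℝ) x).setIntegral_preimage_emb
    (measurableEmbedding_addLeft x) gaussPdf (Iic x)
  simp only [preimage_const_add_Iic, sub_self] at this
  rw [this]; rfl

lemma mills {x y : ℝ} (h : x ≤ y) : gaussPdf y * gaussCdf x ≤ gaussPdf x * gaussCdf y := by
  rw [gaussCdf_shift, gaussCdf_shift, ← integral_const_mul, ← integral_const_mul]
  apply setIntegral_mono_on
  · exact ((gaussPdf_int.comp_add_left x).const_mul _).integrableOn
  · exact ((gaussPdf_int.comp_add_left y).const_mul _).integrableOn
  · exact measurableSet_Iic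
  · intro u hu
    have hu : u ≤ 0 := hu
    unfold gaussPdf
    have e : ∀ a b : ℝ, (2 * Real.pi) ^ (-(1:ℝ)/2) * Real.exp a * ((2 * Real.pi) ^ (-(1:ℝ)/2) * Real.exp b)
      = ((2 * Real.pi) ^ (-(1:ℝ)/2)) ^ 2 * Real.exp (a + b) := by
      intro a b; rw [Real.exp_add]; ring
    rw [e, e]
    gcongr ?_ * Real.exp ?_
    nlinarith

lemma pdf_le_sqrt_cdf : ∃ C : ℝ, 0 ≤ C ∧ ∀ x, gaussPdf x ≤ C * √(gaussCdf x) := by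
  set c : ℝ := (2 * Real.pi) ^ (-(1:ℝ)/2) with hc
  have hc0 : 0 < c := by positivity
  refine ⟨√(c * Real.exp 1), by positivity, fun x => ?_⟩
  rw [← Real.sqrt_mul (by positivity)]
  apply Real.le_sqrt_of_sq_le
  have h1 : c * Real.exp (-x^2 - 1) ≤ gaussCdf x := by
    rw [gaussCdf_shift]
    have h2 : ∫ u in Icc (-1:ℝ) 0, c * Real.exp (-x^2 - 1) ≤ ∫ u in Icc (-1:ℝ) 0, gaussPdf (x + u) := by
      apply setIntegral_mono_on
      · exact continuous_const.integrableOn_Icc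
      · exact (gaussPdf_int.comp_add_left x).integrableOn
      · exact measurableSet_Icc
      · intro u hu
        unfold gaussPdf
        rw [← hc]
        gcongr
        nlinarith [hu.1, hu.2, sq_nonneg (x - u)]
    have h3 : ∫ u in Icc (-1:ℝ) 0, gaussPdf (x + u) ≤ ∫ u in Iic (0:ℝ), gaussPdf (x + u) := by
      apply setIntegral_mono_set
      · exact (gaussPdf_int.comp_add_left x).integrableOn
      · exact Eventually.of_forall fun u => (gaussPdf_pos _).le
      · exact Eventually.of_forall fun u hu => hu.2
    have h4 : ∫ u in Icc (-1:ℝ) 0, c * Real.exp (-x^2 - 1) = c * Real.exp (-x^2 - 1) := by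
      simp
    linarith
  calc gaussPdf x ^ 2 = c * Real.exp 1 * (c * Real.exp (-x^2 - 1)) := by
        unfold gaussPdf
        rw [← hc, mul_pow, ← Real.exp_nat_mul, mul_mul_mul_comm, ← Real.exp_add]
        ring_nf
    _ ≤ _ := by gcongr

lemma unif_gauss {A : Set ℝ} (hA : MeasurableSet A) :
    gaussianReal 0 1 (gaussCdf ⁻¹' A) = volume (A ∩ Ioo 0 1) := by
  have h := lintegral_image_eq_lintegral_abs_deriv_mul (s := univ) MeasurableSet.univ
    (fun x _ => (gaussCdf_hasDeriv x).hasDerivWithinAt) gaussCdf_strictMono.injective.injOn (A.indicator 1)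
  rw [image_univ, gaussCdf_range, lintegral_indicator_one hA, Measure.restrict_apply hA] at h
  rw [h, gaussianReal_apply _ one_ne_zero, ← lintegral_indicator (gaussCdf_cont.measurable hA)]
  simp only [Measure.restrict_univ]
  apply lintegral_congr
  intro x
  rw [abs_of_pos (gaussPdf_pos x), gaussPdf_eq]
  by_cases hx : gaussCdf x ∈ A
  · simp [hx, gaussianPDF]
  · simp [hx]

lemma unif_gm (n : ℕ) [NeZero n] {A : Set ℝ} (hA : MeasurableSet A) :
    gaussMeasure n {x | gaussCdf (x 0) ∈ A} = volume (A ∩ Ioo 0 1) := by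
  rw [← unif_gauss hA]
  exact (measurePreserving_eval (fun _ : Fin n => gaussianReal 0 1) 0).measure_preimage
    (gaussCdf_cont.measurable hA).nullMeasurableSet
lemma distFun_anti (n : ℕ) (g : (Fin n → ℝ) → ℝ) : Antitone (distFun n g) := by
  intro a b h
  unfold distFun
  apply ENNReal.toReal_mono (by finiteness)
  apply measure_mono
  intro x hx
  exact lt_of_le_of_lt h hx

lemma distFun_small (n : ℕ) {g : (Fin n → ℝ) → ℝ} (hg : Measurable g) {s : ℝ} (hs : 0 < s) :
    ∃ t : ℝ, 0 ≤ t ∧ distFun n g t ≤ s := by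
  have h : Tendsto (fun m : ℕ => gaussMeasure n {x | (m:ℝ) < |g x|}) atTop
      (𝓝 (gaussMeasure n (⋂ m : ℕ, {x | (m:ℝ) < |g x|}))) := by
    apply tendsto_measure_iInter_atTop
    · intro m
      exact (measurableSet_lt measurable_const (measurable_norm.comp hg)).nullMeasurableSet
    · intro i j hij x hx
      have hx' : (j:ℝ) < |g x| := hx
      have hij' : (i:ℝ) ≤ j := by exact_mod_cast hij
      exact lt_of_le_of_lt hij' hx'
    · exact ⟨0, by finiteness⟩
  have he : (⋂ m : ℕ, {x | (m:ℝ) < |g x|}) = ∅ := by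
    ext x
    simp only [mem_iInter, mem_ofPred_eq, mem_empty_iff_false, iff_false, not_forall, not_lt]
    exact exists_nat_ge _
  rw [he, measure_empty] at h
  obtain ⟨m, hm⟩ := (h.eventually (gt_mem_nhds (show (0:ℝ≥0∞) < ENNReal.ofReal s by simpa))).exists
  refine ⟨m, by positivity, ?_⟩
  exact ENNReal.toReal_le_of_le_ofReal hs.le hm.le

lemma rearr_nonneg (n : ℕ) (g : (Fin n → ℝ) → ℝ) (s : ℝ) : 0 ≤ rearr n g s :=
  Real.sInf_nonneg fun _ h => h.1

lemma rearr_le (n : ℕ) (g : (Fin n → ℝ) → ℝ) {s a : ℝ} (ha : 0 ≤ a) (h : distFun n g a ≤ s) :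
    rearr n g s ≤ a :=
  csInf_le ⟨0, fun _ h => h.1⟩ ⟨ha, h⟩

lemma le_rearr (n : ℕ) {g : (Fin n → ℝ) → ℝ} (hg : Measurable g) {s a : ℝ} (hs : 0 < s)
    (h : s < distFun n g a) : a ≤ rearr n g s := by
  apply le_csInf (distFun_small n hg hs)
  intro b hb
  by_contra hlt
  exact absurd (distFun_anti n g (not_le.1 hlt).le) (by linarith [hb.2])

lemma rearr_anti (n : ℕ) {g : (Fin n → ℝ) → ℝ} (hg : Measurable g) :
    AntitoneOn (rearr n g) (Ioi 0) := by
  intro s hs s' _ h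
  exact csInf_le_csInf ⟨0, fun _ h => h.1⟩ (distFun_small n hg hs) (fun a ha => ⟨ha.1, ha.2.trans h⟩)

lemma hardy (n : ℕ) {g : (Fin n → ℝ) → ℝ} (hg : Measurable g) {k : ℝ → ℝ} (hk : Measurable k)
    (hk0 : ∀ s, 0 ≤ k s) (hki : IntegrableOn k (Ioo 0 1))
    (hd : ∀ a, distFun n g a = (volume ({s | a < k s} ∩ Ioo 0 1)).toReal) {t : ℝ}
    (ht : t ∈ Ioo (0:ℝ) 1) :
    ∫ s in Ioc 0 t, k s ≤ ∫ s in (0:ℝ)..t, rearr n g s := by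
  have hd' : ∀ a, volume ({s | a < k s} ∩ Ioo 0 1) = ENNReal.ofReal (distFun n g a) := by
    intro a
    rw [hd, ENNReal.ofReal_toReal]
    refine ne_top_of_le_ne_top ?_ (measure_mono inter_subset_right)
    simp
  have mr : AEMeasurable (rearr n g) (volume.restrict (Ioc 0 t)) :=
    aemeasurable_restrict_of_antitoneOn measurableSet_Ioc
      ((rearr_anti n hg).mono fun x hx => hx.1)
  have sub : Ioc 0 t ⊆ Ioo (0:ℝ) 1 := fun x hx => ⟨hx.1, hx.2.trans_lt ht.2⟩
  have low : ∫⁻ s in Ioc 0 t, ENNReal.ofReal (k s) ≤ ∫⁻ s in Ioc 0 t, ENNReal.ofReal (rearr n g s) := by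
    rw [lintegral_eq_lintegral_meas_lt _ (Eventually.of_forall hk0) hk.aemeasurable,
      lintegral_eq_lintegral_meas_le _ (Eventually.of_forall (rearr_nonneg n g)) mr]
    apply lintegral_mono
    intro a
    simp only
    rw [Measure.restrict_apply (measurableSet_lt measurable_const hk)]
    have h1 : volume ({s | a < k s} ∩ Ioc 0 t) ≤ ENNReal.ofReal (min t (distFun n g a)) := by
      rw [(ENNReal.ofReal_mono).map_min]
      refine le_min ?_ ?_
      · refine (measure_mono inter_subset_right).trans ?_
        simp
      · rw [← hd']
        exact measure_mono (inter_subset_inter_right _ sub)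
    refine h1.trans ?_
    have h2 : Ioo 0 (min t (distFun n g a)) ⊆ {s | a ≤ rearr n g s} ∩ Ioc 0 t := by
      intro s hs
      have := lt_min_iff.1 hs.2
      exact ⟨le_rearr n hg hs.1 this.2, hs.1, this.1.le⟩
    calc _ = volume (Ioo 0 (min t (distFun n g a))) := by simp
      _ ≤ _ := measure_mono h2
      _ ≤ _ := Measure.le_restrict_apply _ _
  have up : ∫⁻ s in Ioc 0 t, ENNReal.ofReal (rearr n g s) ≤ ∫⁻ s in Ioo 0 1, ENNReal.ofReal (k s) := by
    rw [lintegral_eq_lintegral_meas_lt _ (Eventually.of_forall hk0) hk.aemeasurable,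
      lintegral_eq_lintegral_meas_lt _ (Eventually.of_forall (rearr_nonneg n g)) mr]
    apply setLIntegral_mono' measurableSet_Ioi
    intro a ha
    have ha : 0 < a := ha
    rw [Measure.restrict_apply (measurableSet_lt measurable_const hk), hd',
      Measure.restrict_apply' measurableSet_Ioc]
    calc _ ≤ volume (Ioo 0 (distFun n g a)) := by
          apply measure_mono
          rintro s ⟨hs, hs2⟩
          refine ⟨hs2.1, ?_⟩
          by_contra hcon
          exact absurd (rearr_le n g ha.le (not_lt.1 hcon)) (not_le.2 hs)
      _ = _ := by simp
  have fin : ∫⁻ s in Ioc 0 t, ENNReal.ofReal (rearr n g s) ≠ ∞ := by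
    refine ne_top_of_le_ne_top ?_ up
    exact (hki.lintegral_lt_top).ne
  rw [intervalIntegral.integral_of_le ht.1.le,
    integral_eq_lintegral_of_nonneg_ae (Eventually.of_forall hk0) hk.aestronglyMeasurable,
    integral_eq_lintegral_of_nonneg_ae (Eventually.of_forall (rearr_nonneg n g)) mr.aestronglyMeasurable]
  exact ENNReal.toReal_mono fin low
lemma memLp4_id (n : ℕ) : MemLp (id : (Fin n → ℝ) → (Fin n → ℝ)) ((4:ℕ) : ℝ≥0∞) (gaussMeasure n) := by
  have := isGaussian_gm n
  exact IsGaussian.memLp_id _ _ (ENNReal.natCast_ne_top 4)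
lemma memLp4_aff (n : ℕ) (c K : ℝ) : MemLp (fun x : Fin n → ℝ => c + K * ‖x‖) ((4:ℕ) : ℝ≥0∞) (gaussMeasure n) := by
  have h4 := memLp4_id n
  have h5 := (h4.norm.const_mul K)
  exact (memLp_const c).add h5
lemma memLp4_lip (n : ℕ) {f : (Fin n → ℝ) → ℝ} {K : ℝ≥0} (hf : LipschitzWith K f) : MemLp f ((4:ℕ) : ℝ≥0∞) (gaussMeasure n) := by
    have hb := memLp4_aff n |f 0| K
    refine hb.of_le hf.continuous.aestronglyMeasurable (Eventually.of_forall fun x => ?_)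
    have h1 := hf.dist_le_mul x 0
    rw [Real.dist_eq, dist_zero_right] at h1
    have h2 := abs_sub_abs_le_abs_sub (f x) (f 0)
    rw [Real.norm_eq_abs, Real.norm_eq_abs]
    exact le_trans (by linarith) (le_abs_self _)
lemma rearr_int4 (n : ℕ) {f : (Fin n → ℝ) → ℝ} {K : ℝ≥0} (hf : LipschitzWith K f) :
    Integrable (fun x => ‖f x‖ ^ 4) (gaussMeasure n) := (memLp4_lip n hf).integrable_norm_pow (by norm_num)

lemma rearr_tail (n : ℕ) {f : (Fin n → ℝ) → ℝ} {K : ℝ≥0} (hf : LipschitzWith K f) :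
    ∃ C : ℝ, 0 ≤ C ∧ ∀ s, 0 < s → rearr n f s * √(√s) ≤ C := by
  have hi := rearr_int4 n hf
  obtain ⟨M, hM⟩ : ∃ M, M = ∫ x, ‖f x‖ ^ 4 ∂(gaussMeasure n) := ⟨_, rfl⟩
  have hM0 : 0 ≤ M := hM ▸ integral_nonneg fun x => by positivity
  refine ⟨M + 1, by positivity, fun s hs => ?_⟩
  have hq : 0 < √(√s) := by positivity
  have hq4 : √(√s) ^ 4 = s := by
    have : √(√s) ^ 4 = ((√(√s)) ^ 2) ^ 2 := by ring
    rw [this, Real.sq_sqrt (by positivity), Real.sq_sqrt hs.le]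
  rw [← le_div_iff₀ hq]
  set a := (M + 1) / √(√s) with ha
  have ha0 : 0 < a := by positivity
  apply rearr_le n f ha0.le
  have hmk := mul_meas_ge_le_integral_of_nonneg (μ := gaussMeasure n) (f := fun x => ‖f x‖ ^ 4)
    (Eventually.of_forall fun x => by positivity) hi (a ^ 4)
  have h5 : distFun n f a ≤ (gaussMeasure n).real {x | a ^ 4 ≤ ‖f x‖ ^ 4} := by
    apply ENNReal.toReal_mono (by finiteness)
    apply measure_mono
    intro x hx
    have hx : a < |f x| := hx
    exact pow_le_pow_left₀ ha0.le hx.le 4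
  have h6 : a ^ 4 * distFun n f a ≤ M := (mul_le_mul_of_nonneg_left h5 (by positivity)).trans (hM ▸ hmk)
  have h7 : a ^ 4 * s = (M + 1) ^ 4 := by
    rw [ha, div_pow, hq4]; field_simp
  have h8 : M ≤ (M + 1) ^ 4 := by
    have := le_self_pow₀ (show (1:ℝ) ≤ M + 1 by linarith) (show (4:ℕ) ≠ 0 by norm_num)
    linarith
  have : a ^ 4 * distFun n f a ≤ a ^ 4 * s := by linarith
  exact le_of_mul_le_mul_left this (by positivity)

lemma tight_gm (n : ℕ) {d : ℝ} (hd : 0 < d) : ∃ R : ℝ≥0, gaussMeasure n {x | R < ‖x‖} ≤ ENNReal.ofReal d := by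
  obtain ⟨t, ht, h⟩ := distFun_small n (g := fun x => ‖x‖) (by fun_prop) hd
  refine ⟨⟨t, ht⟩, ?_⟩
  unfold distFun at h
  simp only [abs_norm] at h
  exact ENNReal.le_ofReal_iff_toReal_le (by finiteness) hd.le |>.2 h

lemma rearr_lip (n : ℕ) {f : (Fin n → ℝ) → ℝ} {K : ℝ≥0} (hf : LipschitzWith K f) {p q : ℝ}
    (hp : 0 < p) (hq : q < 1) : ∃ L : ℝ≥0, LipschitzOnWith L (rearr n f) (Icc p q) := by
  set d := min p (1 - q) with hd
  have hd0 : 0 < d := lt_min hp (by linarith)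
  have hdp : d ≤ p := min_le_left _ _
  have hdq : d ≤ 1 - q := min_le_right _ _
  obtain ⟨R, hR⟩ := tight_gm n (half_pos hd0)
  have hfm := hf.continuous.measurable
  set g := fun x => |f x| with hgdef
  have hg : LipschitzWith K g := by
    have := lipschitzWith_one_norm (E := ℝ) |>.comp hf
    simpa [Function.comp_def] using this
  have e1 : ENNReal.ofReal d / 2 = ENNReal.ofReal (d / 2) := by
    rw [ENNReal.ofReal_div_of_pos two_pos]; simp
  set Q : ℝ := (K * (2 * R) : ℝ≥0) * (π / 2) with hQ
  have hQ0 : 0 ≤ Q := by positivity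
  have main : ∀ a b : ℝ, a < b → d ≤ distFun n f b → d ≤ 1 - distFun n f a →
      (b - a) * (d / 2 * (d / 2)) ≤ Q * (distFun n f a - distFun n f b) := by
    intro a b hab hb ha
    have mA : MeasurableSet {x | a < g x} := measurableSet_lt measurable_const hg.continuous.measurable
    have mB : MeasurableSet {x | b < g x} := measurableSet_lt measurable_const hg.continuous.measurable
    have ca : {x | g x ≤ a} = {x | a < g x}ᶜ := by ext x; simp
    have h1 : ENNReal.ofReal d ≤ gaussMeasure n {x | b < g x} := ENNReal.ofReal_le_of_le_toReal hb
    have h2 : ENNReal.ofReal d ≤ gaussMeasure n {x | g x ≤ a} := by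
      apply ENNReal.ofReal_le_of_le_toReal
      rw [ca]
      have := probReal_compl_eq_one_sub (μ := gaussMeasure n) mA
      unfold Measure.real at this
      rw [this]
      exact ha
    have h3 := gap n hg (e1 ▸ hR) (by finiteness) h1 h2
    have cg : {x | a < g x ∧ g x ≤ b} = {x | a < g x} \ {x | b < g x} := by
      ext x; simp
    have h4 : (gaussMeasure n {x | a < g x ∧ g x ≤ b}).toReal = distFun n f a - distFun n f b := by
      rw [cg]
      exact measureReal_sdiff (fun x hx => hab.trans hx) mB
    have h5 := ENNReal.toReal_mono (by finiteness) h3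
    rw [e1] at h5
    simp only [ENNReal.toReal_mul, h4] at h5
    rw [ENNReal.toReal_ofReal (by linarith), ENNReal.toReal_ofReal (by linarith),
      ENNReal.toReal_ofReal (by positivity)] at h5
    simpa [hQ] using h5
  set L := Q / (d / 2 * (d / 2)) with hL
  have hL0 : 0 ≤ L := by positivity
  have main2 : ∀ s ∈ Icc p q, ∀ s' ∈ Icc p q, s ≤ s' →
      rearr n f s - rearr n f s' ≤ L * (s' - s) := by
    intro s hs s' hs' hss
    by_contra hcon
    have hcon := not_le.1 hcon
    have hv : 0 ≤ L * (s' - s) := mul_nonneg hL0 (by linarith)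
    set η := (rearr n f s - rearr n f s' - L * (s' - s)) / 4 with hη
    have hη0 : 0 < η := by rw [hη]; linarith
    have ha0 := rearr_nonneg n f s'
    set a := rearr n f s' + η
    set b := rearr n f s - η
    have hba : b - a = (rearr n f s - rearr n f s' - L * (s' - s)) / 2 + L * (s' - s) := by
      simp only [a, b, hη]; ring
    have hab : a < b := by linarith
    have hs0 : 0 < s := hp.trans_le hs.1
    have hs0' : 0 < s' := hp.trans_le hs'.1
    have hDb : s < distFun n f b := by
      by_contra h
      have := rearr_le n f (by linarith [ha0, hη0] : 0 ≤ b) (not_lt.1 h)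
      simp only [b] at this
      linarith
    have hDa : distFun n f a ≤ s' := by
      by_contra h
      have := le_rearr n hfm hs0' (not_le.1 h)
      simp only [a] at this
      linarith
    have h6 := main a b hab (by linarith [hs.1]) (by linarith [hs'.2])
    have h7 : (b - a) ≤ L * (distFun n f a - distFun n f b) := by
      rw [hL, div_mul_eq_mul_div, le_div_iff₀ (by positivity)]
      exact h6
    have h8 : L * (distFun n f a - distFun n f b) ≤ L * (s' - s) :=
      mul_le_mul_of_nonneg_left (by linarith) hL0
    linarith
  refine ⟨⟨L, hL0⟩, LipschitzOnWith.of_dist_le_mul ?_⟩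
  intro s hs s' hs'
  rw [Real.dist_eq, Real.dist_eq]
  change _ ≤ L * _
  have anti := rearr_anti n hfm
  rcases le_total s s' with h | h
  · have h1 := anti (hp.trans_le hs.1 : 0 < s) (hp.trans_le hs'.1 : 0 < s') h
    rw [abs_of_nonneg (by linarith), abs_of_nonpos (by linarith)]
    linarith [main2 s hs s' hs' h]
  · have h1 := anti (hp.trans_le hs'.1 : 0 < s') (hp.trans_le hs.1 : 0 < s) h
    rw [abs_of_nonpos (by linarith), abs_of_nonneg (by linarith)]
    linarith [main2 s' hs' s hs h]
lemma exists_J : ∃ J : ℝ → ℝ, Measurable J ∧ ∀ x, J (gaussCdf x) = gaussPdf x := by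
  have he : MeasurableEmbedding gaussCdf :=
    gaussCdf_cont.measurableEmbedding gaussCdf_strictMono.injective
  obtain ⟨J, hJ, h⟩ := he.exists_measurable_extend gaussPdf_cont.measurable (fun _ => ⟨0⟩)
  exact ⟨J, hJ, fun x => congrFun h x⟩

lemma rearr_ae_diff (n : ℕ) {f : (Fin n → ℝ) → ℝ} (hf : Measurable f) :
    ∀ᵐ s, s ∈ Ioo (0:ℝ) 1 → DifferentiableAt ℝ (rearr n f) s := by
  have h : MonotoneOn (fun s => - rearr n f s) (Ioi 0) := (rearr_anti n hf).neg
  filter_upwards [h.ae_differentiableWithinAt_of_mem] with s hs hs1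
  have h1 := (hs hs1.1).differentiableAt (Ioi_mem_nhds hs1.1)
  simpa using h1.neg

lemma grad_eq (n : ℕ) [NeZero n] {f : (Fin n → ℝ) → ℝ} (x : Fin n → ℝ)
    (h : DifferentiableAt ℝ (rearr n f) (gaussCdf (x 0))) :
    gradNorm n (gaussSymm n f) x = |deriv (rearr n f) (gaussCdf (x 0)) * gaussPdf (x 0)| := by
  have h1 : HasDerivAt (fun y => rearr n f (gaussCdf y))
      (deriv (rearr n f) (gaussCdf (x 0)) * gaussPdf (x 0)) (x 0) :=
    h.hasDerivAt.comp (x 0) (gaussCdf_hasDeriv (x 0))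
  have h2 : HasFDerivAt (fun x : Fin n → ℝ => x 0)
      (ContinuousLinearMap.proj (R := ℝ) (φ := fun _ : Fin n => ℝ) 0) x := hasFDerivAt_apply 0 x
  have h3 := h1.comp_hasFDerivAt x h2
  have h4 : HasFDerivAt (gaussSymm n f) _ x := h3
  have hn : ‖ContinuousLinearMap.proj (R := ℝ) (φ := fun _ : Fin n => ℝ) 0‖ = 1 := by
    apply le_antisymm
    · apply ContinuousLinearMap.opNorm_le_bound _ zero_le_one
      intro y
      simpa using norm_le_pi_norm y 0
    · have := (ContinuousLinearMap.proj (R := ℝ) (φ := fun _ : Fin n => ℝ) 0).le_opNorm (fun _ => 1)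
      have h5 : ‖(fun _ : Fin n => (1:ℝ))‖ ≤ 1 := by
        rw [pi_norm_le_iff_of_nonneg zero_le_one]; simp
      simp only [ContinuousLinearMap.proj_apply, norm_one] at this
      nlinarith [norm_nonneg (ContinuousLinearMap.proj (R := ℝ) (φ := fun _ : Fin n => ℝ) 0)]
  rw [gradNorm, h4.fderiv, norm_smul, hn, Real.norm_eq_abs, mul_one]

lemma k_int (n : ℕ) {f : (Fin n → ℝ) → ℝ} {K : ℝ≥0} (hf : LipschitzWith K f) {J : ℝ → ℝ}
    (hJ : Measurable J) (hJ2 : ∀ x, J (gaussCdf x) = gaussPdf x) :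
    IntegrableOn (fun s => |deriv (rearr n f) s * J s|) (Ioo 0 1) := by
  obtain ⟨C, hC0, hC⟩ := rearr_tail n hf
  obtain ⟨D, hD0, hD⟩ := pdf_le_sqrt_cdf
  have hfm := hf.continuous.measurable
  have anti := rearr_anti n hfm
  set r := rearr n f with hr
  set G : ℝ → ℝ := fun s => - r s * √s + 2 * C * √(√s) with hG
  have mono : MonotoneOn G (Icc 0 1) := by
    intro s hs s' hs' hss
    rcases hss.eq_or_lt with rfl | hlt
    · exact le_rfl
    have hs0' : 0 < s' := lt_of_le_of_lt hs.1 hlt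
    have hu' : 0 < √(√s') := by positivity
    have huu : √(√s) ≤ √(√s') := Real.sqrt_le_sqrt (Real.sqrt_le_sqrt hss)
    have hu0 : 0 ≤ √(√s) := by positivity
    have e1 : √(√s) ^ 2 = √s := Real.sq_sqrt (by positivity)
    have e2 : √(√s') ^ 2 = √s' := Real.sq_sqrt (by positivity)
    have hrs : r s' * √s ≤ r s * √s := by
      rcases hs.1.eq_or_lt with h0 | h0
      · rw [← h0]; simp
      · exact mul_le_mul_of_nonneg_right (anti h0 hs0' hss) (by positivity)
    have hCs := hC s' hs0'
    simp only [hG]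
    generalize √(√s) = u at *
    generalize √(√s') = u' at *
    rw [← e1] at hrs ⊢
    rw [← e2]
    have h1 : r s' * u' * (u' - u) ≤ C * (u' - u) := mul_le_mul_of_nonneg_right hCs (by linarith)
    have h2 : r s' * u * (u' - u) ≤ r s' * u' * (u' - u) :=
      mul_le_mul_of_nonneg_right
        (mul_le_mul_of_nonneg_left huu (rearr_nonneg n f s')) (by linarith)
    nlinarith
  have gi : IntegrableOn (deriv G) (Ioo 0 1) := by
    have := MonotoneOn.intervalIntegrable_deriv (f := G) (a := 0) (b := 1)
      (by rwa [uIcc_of_le zero_le_one])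
    rw [intervalIntegrable_iff_integrableOn_Ioo_of_le zero_le_one] at this
    exact this
  refine Integrable.mono' (gi.const_mul D) ?_ ?_
  · exact ((measurable_deriv r).mul hJ).norm.aestronglyMeasurable
  · rw [ae_restrict_iff' measurableSet_Ioo]
    filter_upwards [rearr_ae_diff n hfm] with s hs hs1
    have hd := (hs hs1).hasDerivAt
    have hs0 : 0 < s := hs1.1
    have hq : 0 < √s := by positivity
    have hqq : 0 < √(√s) := by positivity
    have h1 : HasDerivAt (fun s => √s) (1 / (2 * √s)) s := Real.hasDerivAt_sqrt hs0.ne'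
    have h2 : HasDerivAt (fun s => √(√s)) (1 / (2 * √s) / (2 * √(√s))) s := h1.sqrt hq.ne'
    have h3 : HasDerivAt G (-deriv r s * √s + (- r s) * (1 / (2 * √s)) +
      2 * C * (1 / (2 * √s) / (2 * √(√s)))) s :=
      (hd.neg.mul h1).add (h2.const_mul (2 * C))
    have hneg : deriv r s ≤ 0 := by
      rw [← derivWithin_of_mem_nhds (Ioi_mem_nhds hs0)]
      exact anti.derivWithin_nonpos
    obtain ⟨x, hx⟩ : s ∈ range gaussCdf := by rw [gaussCdf_range]; exact hs1
    have hJs : J s ≤ D * √s := by rw [← hx, hJ2]; exact hD x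
    have hJ0 : 0 ≤ J s := by rw [← hx, hJ2]; exact (gaussPdf_pos x).le
    have hge : -deriv r s * √s ≤ deriv G s := by
      rw [h3.deriv]
      have : 0 ≤ (- r s) * (1 / (2 * √s)) + 2 * C * (1 / (2 * √s) / (2 * √(√s))) := by
        have e : (- r s) * (1 / (2 * √s)) + 2 * C * (1 / (2 * √s) / (2 * √(√s)))
          = (C - r s * √(√s)) * (1 / (2 * √s) / √(√s)) := by
          field_simp
          ring
        rw [e]
        have := hC s hs0
        have h4 : 0 ≤ C - r s * √(√s) := by linarith
        positivity
      linarith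
    rw [norm_abs_eq_norm, Real.norm_eq_abs, abs_mul, abs_of_nonpos hneg, abs_of_nonneg hJ0]
    calc -deriv r s * J s ≤ -deriv r s * (D * √s) := by
          apply mul_le_mul_of_nonneg_left hJs; linarith
      _ = D * (-deriv r s * √s) := by ring
      _ ≤ _ := by gcongr

lemma dist_grad (n : ℕ) [NeZero n] {f : (Fin n → ℝ) → ℝ} (hf : Measurable f) {J : ℝ → ℝ}
    (hJ : Measurable J) (hJ2 : ∀ x, J (gaussCdf x) = gaussPdf x) (a : ℝ) :
    distFun n (gradNorm n (gaussSymm n f)) a =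
      (volume ({s | a < |deriv (rearr n f) s * J s|} ∩ Ioo 0 1)).toReal := by
  have hA : MeasurableSet {s | a < |deriv (rearr n f) s * J s|} :=
    measurableSet_lt measurable_const ((measurable_deriv _).mul hJ).norm
  rw [← unif_gm n hA, distFun]
  congr 1
  apply measure_congr
  have hD : MeasurableSet {s | DifferentiableAt ℝ (rearr n f) s} := measurableSet_of_differentiableAt ℝ _
  have h0 : gaussMeasure n {x | gaussCdf (x 0) ∈ {s | DifferentiableAt ℝ (rearr n f) s}ᶜ} = 0 := by
    rw [unif_gm n hD.compl]
    have := rearr_ae_diff n hf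
    rw [ae_iff] at this
    convert this using 2
    ext s
    simp only [mem_inter_iff, mem_compl_iff, mem_ofPred_eq, Classical.not_imp]
    tauto
  have h1 : ∀ᵐ x ∂(gaussMeasure n), DifferentiableAt ℝ (rearr n f) (gaussCdf (x 0)) := by
    rw [ae_iff]; exact h0
  filter_upwards [h1] with x hx
  have h2 := grad_eq n x hx
  apply propext
  change a < |gradNorm n (gaussSymm n f) x| ↔ a < |deriv (rearr n f) (gaussCdf (x 0)) * J (gaussCdf (x 0))|
  rw [h2, hJ2, abs_abs]
lemma main_eps (n : ℕ) [NeZero n] {f : (Fin n → ℝ) → ℝ} {K : ℝ≥0} (hf : LipschitzWith K f)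
    {t : ℝ} (ht : t ∈ Ioo (0:ℝ) 1) {e : ℝ} (he : 0 < e) (het : e ≤ t) :
    ∫ s in e..t, rearr n f s ≤ t * rearr n f t + t / Igauss t *
      ∫ s in (0:ℝ)..t, rearr n (gradNorm n (gaussSymm n f)) s := by
  obtain ⟨J, hJ, hJ2⟩ := exists_J
  have hfm := hf.continuous.measurable
  have ki := k_int n hf hJ hJ2
  have hgm : Measurable (gradNorm n (gaussSymm n f)) := (measurable_fderiv ℝ _).norm
  have hk : Measurable (fun s => |deriv (rearr n f) s * J s|) := ((measurable_deriv _).mul hJ).norm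
  have hh := hardy n hgm hk (fun s => abs_nonneg _) ki (dist_grad n hfm hJ hJ2) ht
  obtain ⟨L, hL⟩ := rearr_lip n hf he ht.2
  have ac : AbsolutelyContinuousOnInterval (rearr n f) e t :=
    LipschitzOnWith.absolutelyContinuousOnInterval (by rwa [uIcc_of_le het])
  have acid : AbsolutelyContinuousOnInterval (fun s : ℝ => s) e t :=
    (LipschitzWith.id.lipschitzOnWith).absolutelyContinuousOnInterval
  have parts := acid.integral_mul_deriv_eq_deriv_mul ac
  simp only [deriv_id'', one_mul] at parts
  have hI : Igauss t = gaussPdf (gaussCdfInv t) := by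
    rw [Igauss, if_neg]; push Not; exact ⟨ht.1.ne', ht.2.ne⟩
  have hIpos : 0 < Igauss t := by rw [hI]; exact gaussPdf_pos _
  have sub : Ioc e t ⊆ Ioc 0 t := Ioc_subset_Ioc_left he.le
  have sub2 : Ioc 0 t ⊆ Ioo (0:ℝ) 1 := fun x hx => ⟨hx.1, hx.2.trans_lt ht.2⟩
  have ki2 := ki.mono_set sub2
  have step : ∫ s in e..t, -(s * deriv (rearr n f) s) ≤
      ∫ s in e..t, t / Igauss t * |deriv (rearr n f) s * J s| := by
    apply intervalIntegral.integral_mono_on het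
    · exact (ac.intervalIntegrable_deriv.continuousOn_mul acid.continuousOn).neg
    · rw [intervalIntegrable_iff_integrableOn_Ioc_of_le het]
      exact (ki2.mono_set sub).const_mul _
    · intro s hs
      have hs1 : s ∈ Ioo (0:ℝ) 1 := ⟨he.trans_le hs.1, hs.2.trans_lt ht.2⟩
      obtain ⟨x, hx⟩ : s ∈ range gaussCdf := by rw [gaussCdf_range]; exact hs1
      obtain ⟨y, hy⟩ : t ∈ range gaussCdf := by rw [gaussCdf_range]; exact ht
      have hxy : x ≤ y := by
        rw [← gaussCdf_strictMono.le_iff_le, hx, hy]; exact hs.2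
      have hm := mills hxy
      have hIy : Igauss t = gaussPdf y := by rw [hI, ← hy, gaussCdfInv_cdf]
      have hJs : J s = gaussPdf x := by rw [← hx, hJ2]
      rw [hx, hy] at hm
      rw [abs_mul, hJs, hIy, abs_of_pos (gaussPdf_pos x), div_mul_eq_mul_div,
        le_div_iff₀ (gaussPdf_pos y)]
      have h1 := neg_abs_le (deriv (rearr n f) s)
      calc -(s * deriv (rearr n f) s) * gaussPdf y
          = (-deriv (rearr n f) s) * (gaussPdf y * s) := by ring
        _ ≤ |deriv (rearr n f) s| * (gaussPdf y * s) := by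
          apply mul_le_mul_of_nonneg_right (neg_le_abs _)
          exact mul_nonneg (gaussPdf_pos y).le hs1.1.le
        _ ≤ |deriv (rearr n f) s| * (gaussPdf x * t) := by gcongr
        _ = _ := by ring
  rw [intervalIntegral.integral_neg, parts, intervalIntegral.integral_const_mul] at step
  have h2 : ∫ s in e..t, |deriv (rearr n f) s * J s| ≤ ∫ s in Ioc 0 t, |deriv (rearr n f) s * J s| := by
    rw [intervalIntegral.integral_of_le het]
    exact setIntegral_mono_set ki2 (Eventually.of_forall fun s => abs_nonneg _)
      (Eventually.of_forall sub)
  have h3 := mul_le_mul_of_nonneg_left (h2.trans hh) (div_nonneg ht.1.le hIpos.le)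
  have h4 : 0 ≤ e * rearr n f e := mul_nonneg he.le (rearr_nonneg _ _ _)
  linarith

/-- For Lipschitz `f`, the oscillation `f**(t) - f*(t)` is controlled by the maximal
function of the gradient of the Gaussian symmetrization `f°`. -/
theorem oscillation_le_symmetrization_gradient (n : ℕ) [NeZero n]
    (f : (Fin n → ℝ) → ℝ) (hf : ∃ K, LipschitzWith K f) :
    ∀ t ∈ Set.Ioo (0:ℝ) 1,
      rearr2 n f t - rearr n f t ≤
        t / Igauss t * rearr2 n (gradNorm n (gaussSymm n f)) t := by
  intro t ht
  obtain ⟨K, hf⟩ := hf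
  set H := ∫ s in (0:ℝ)..t, rearr n (gradNorm n (gaussSymm n f)) s with hH
  have hH0 : 0 ≤ H := intervalIntegral.integral_nonneg ht.1.le fun s _ => rearr_nonneg _ _ _
  have hI0 : 0 ≤ Igauss t := by
    unfold Igauss; split_ifs
    · exact le_rfl
    · exact (gaussPdf_pos _).le
  have hX : 0 ≤ t / Igauss t * H := mul_nonneg (div_nonneg ht.1.le hI0) hH0
  have hr0 : 0 ≤ t * rearr n f t := mul_nonneg ht.1.le (rearr_nonneg _ _ _)
  have key : ∫ s in (0:ℝ)..t, rearr n f s ≤ t * rearr n f t + t / Igauss t * H := by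
    by_cases hint : IntervalIntegrable (rearr n f) volume 0 t
    · have hc : Tendsto (fun e => ∫ s in e..t, rearr n f s) (𝓝[>] 0)
          (𝓝 (∫ s in (0:ℝ)..t, rearr n f s)) := by
        have h1 : IntegrableOn (rearr n f) (uIcc 0 t) := by
          rw [uIcc_of_le ht.1.le, ← intervalIntegrable_iff_integrableOn_Icc_of_le ht.1.le]
          exact hint
        have h2 := intervalIntegral.continuousOn_primitive_interval_left h1
        have h3 : Tendsto (fun e => ∫ s in e..t, rearr n f s) (𝓝[uIcc 0 t] 0) _ := h2 0 left_mem_uIcc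
        refine h3.mono_left ?_
        rw [uIcc_of_le ht.1.le, nhdsWithin_Icc_eq_nhdsGE ht.1]
        exact nhdsWithin_mono _ Ioi_subset_Ici_self
      refine le_of_tendsto hc ?_
      filter_upwards [Ioo_mem_nhdsGT ht.1] with e he
      exact main_eps n hf ht he.1 he.2.le
    · rw [intervalIntegral.integral_undef hint]
      linarith
  unfold rearr2
  rw [← hH]
  have ht0 := ht.1
  have h5 := mul_le_mul_of_nonneg_left key (show 0 ≤ 1 / t by positivity)
  have h6 : 1 / t * (t * rearr n f t + t / Igauss t * H) = rearr n f t + t / Igauss t * (1 / t * H) := by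
    rw [mul_add, ← mul_assoc (1/t) t, one_div_mul_cancel ht0.ne']; ring
  linarith
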